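/- Let G be the N × N diagonal matrix over k with G_{kk} = q^{−2k}, and set G₁ := G ⊗ I and G₂ := I ⊗ G. Then R^{t₂} is invertible with (R^{t₂})⁻¹ = G₁ (R₂₁⁻¹)^{t₁} G₁⁻¹ = G₂ (R₂₁⁻¹)^{t₁} G₂⁻¹, and likewise (R₂₁⁻¹)^{t₂} is invertible with ((R₂₁⁻¹)^{t₂})⁻¹ = G₁ R^{t₁} G₁⁻¹ = G₂ R^{t₁} G₂⁻¹. -/

import Mathlib

open scoped BigOperators TensorProduct

noncomputable section

abbrev K : Type := RatFunc ℂ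

def q : K := RatFunc.X

/-- The standard R-matrix of `U_q(gl_N)`: the coefficient of `e_{ik} ⊗ e_{jl}` is the
entry at row `(i,j)`, column `(k,l)`. -/
def Rmat (N : ℕ) : Matrix (Fin N × Fin N) (Fin N × Fin N) K :=
  Matrix.of fun p c =>
    if p.1 = c.1 ∧ p.2 = c.2 then (if p.1 = p.2 then q else 1)
    else if p.1 = c.2 ∧ p.2 = c.1 ∧ c.1 < p.1 then q - q⁻¹
    else 0

/-- partial transpose in the first tensor factor -/
def pt1 {N : ℕ} {α : Type} (C : Matrix (Fin N × Fin N) (Fin N × Fin N) α) :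
    Matrix (Fin N × Fin N) (Fin N × Fin N) α :=
  Matrix.of fun p c => C (c.1, p.2) (p.1, c.2)

/-- partial transpose in the second tensor factor -/
def pt2 {N : ℕ} {α : Type} (C : Matrix (Fin N × Fin N) (Fin N × Fin N) α) :
    Matrix (Fin N × Fin N) (Fin N × Fin N) α :=
  Matrix.of fun p c => C (p.1, c.2) (c.1, p.2)

/-- flip of the two tensor factors -/
def flip21 {N : ℕ} {α : Type} (C : Matrix (Fin N × Fin N) (Fin N × Fin N) α) :
    Matrix (Fin N × Fin N) (Fin N × Fin N) α :=
  Matrix.of fun p c => C (p.2, p.1) (c.2, c.1)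

/-- the diagonal matrix `G` with `G_{kk} = q^{-2k}` (1-based) -/
def Gdiag (N : ℕ) : Matrix (Fin N) (Fin N) K :=
  Matrix.diagonal fun k => q ^ (-(2 : ℤ) * ((k : ℕ) + 1))

/-- `G₁ = G ⊗ I` -/
def G1 (N : ℕ) : Matrix (Fin N × Fin N) (Fin N × Fin N) K :=
  Matrix.kroneckerMap (· * ·) (Gdiag N) (1 : Matrix (Fin N) (Fin N) K)

/-- `G₂ = I ⊗ G` -/
def G2 (N : ℕ) : Matrix (Fin N × Fin N) (Fin N × Fin N) K :=
  Matrix.kroneckerMap (· * ·) (1 : Matrix (Fin N) (Fin N) K) (Gdiag N)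

lemma q_ne_zero : q ≠ 0 := RatFunc.X_ne_zero

/-- The matrix acting by `B` on the span of the vectors `v_i ⊗ v_i`, and by the identity on
the span of the other basis vectors. -/
def diagBlock {N : ℕ} (B : Matrix (Fin N) (Fin N) K) :
    Matrix (Fin N × Fin N) (Fin N × Fin N) K :=
  Matrix.of fun p c =>
    if p.1 = p.2 then (if c.1 = c.2 then B p.1 c.1 else 0) else if p = c then 1 else 0

lemma diagBlock_mul {N : ℕ} (A B : Matrix (Fin N) (Fin N) K) :
    diagBlock A * diagBlock B = diagBlock (A * B) := by
  ext ⟨a, b⟩ ⟨c, d⟩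
  by_cases h : a = b
  · subst h
    simp only [diagBlock, Matrix.mul_apply, Matrix.of_apply, if_true, Fintype.sum_prod_type,
      ite_mul, zero_mul, Finset.sum_ite_eq, Finset.mem_univ]
    by_cases h' : c = d <;> simp [h']
  · simp only [diagBlock, Matrix.mul_apply, Matrix.of_apply, h, if_false, ite_mul, one_mul,
      zero_mul, Finset.sum_ite_eq, Finset.mem_univ, if_true]

lemma diagBlock_one {N : ℕ} : diagBlock (1 : Matrix (Fin N) (Fin N) K) = 1 := by
  ext ⟨a, b⟩ ⟨c, d⟩
  simp only [diagBlock, Matrix.of_apply, Matrix.one_apply, Prod.mk.injEq]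
  grind

/-- The triangular matrix with `a` on the diagonal and `b` below it. -/
def lowerTri (N : ℕ) (a b : K) : Matrix (Fin N) (Fin N) K :=
  Matrix.of fun i j => if i = j then a else if j < i then b else 0

/-- The explicit inverse of `flip21 (Rmat N)`. -/
def flipRmatInv (N : ℕ) : Matrix (Fin N × Fin N) (Fin N × Fin N) K :=
  Matrix.of fun p c =>
    if p = c then (if p.1 = p.2 then q⁻¹ else 1)
    else if c = p.swap ∧ p.1 < p.2 then -(q - q⁻¹)
    else 0

lemma flip21_Rmat_apply (N : ℕ) (p c : Fin N × Fin N) :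
    flip21 (Rmat N) p c = (if c = p then (if p.1 = p.2 then q else 1) else 0) +
      (if c = p.swap then (if p.1 < p.2 then q - q⁻¹ else 0) else 0) := by
  obtain ⟨a, b⟩ := p
  obtain ⟨c, d⟩ := c
  simp only [flip21, Rmat, Matrix.of_apply, Prod.swap_prod_mk, Prod.mk.injEq]
  grind

lemma flip21_Rmat_mul (N : ℕ) : flip21 (Rmat N) * flipRmatInv N = 1 := by
  have hq := mul_inv_cancel₀ q_ne_zero
  ext ⟨a, b⟩ ⟨c, d⟩
  simp only [Matrix.mul_apply, flip21_Rmat_apply, add_mul, Finset.sum_add_distrib, ite_mul,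
    zero_mul, Finset.sum_ite_eq', Finset.mem_univ, if_true, flipRmatInv, Matrix.of_apply,
    Matrix.one_apply, Prod.swap_prod_mk, Prod.mk.injEq]
  grind

lemma flip21_Rmat_inv (N : ℕ) : (flip21 (Rmat N))⁻¹ = flipRmatInv N :=
  Matrix.inv_eq_right_inv (flip21_Rmat_mul N)

lemma pt2_Rmat (N : ℕ) : pt2 (Rmat N) = diagBlock (lowerTri N q (q - q⁻¹)) := by
  ext ⟨a, b⟩ ⟨c, d⟩
  simp only [pt2, Rmat, diagBlock, lowerTri, Matrix.of_apply, Prod.mk.injEq]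
  grind

lemma pt1_flipRmatInv (N : ℕ) :
    pt1 (flipRmatInv N) = diagBlock (lowerTri N q⁻¹ (-(q - q⁻¹))) := by
  ext ⟨a, b⟩ ⟨c, d⟩
  simp only [pt1, flipRmatInv, diagBlock, lowerTri, Matrix.of_apply, Prod.mk.injEq,
    Prod.swap_prod_mk]
  grind

lemma pt1_eq_transpose {N : ℕ} {α : Type} (C : Matrix (Fin N × Fin N) (Fin N × Fin N) α) :
    pt1 C = (pt2 C).transpose := rfl

lemma pt2_eq_transpose {N : ℕ} {α : Type} (C : Matrix (Fin N × Fin N) (Fin N × Fin N) α) :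
    pt2 C = (pt1 C).transpose := rfl

lemma Gdiag_inv (N : ℕ) :
    (Gdiag N)⁻¹ = Matrix.diagonal fun k : Fin N => q ^ ((2 : ℤ) * ((k : ℕ) + 1)) := by
  apply Matrix.inv_eq_right_inv
  rw [Gdiag, Matrix.diagonal_mul_diagonal, ← Matrix.diagonal_one]
  congr 1
  ext k
  rw [← zpow_add₀ q_ne_zero]
  simp

lemma G1_eq_diagonal (N : ℕ) :
    G1 N = Matrix.diagonal fun p => q ^ (-(2 : ℤ) * ((p.1 : ℕ) + 1)) := by
  simp [G1, Gdiag, ← Matrix.diagonal_one, Matrix.diagonal_kronecker_diagonal]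

lemma G2_eq_diagonal (N : ℕ) :
    G2 N = Matrix.diagonal fun p => q ^ (-(2 : ℤ) * ((p.2 : ℕ) + 1)) := by
  simp [G2, Gdiag, ← Matrix.diagonal_one, Matrix.diagonal_kronecker_diagonal]

lemma isUnit_Gdiag (N : ℕ) : IsUnit (Gdiag N) := by
  rw [Gdiag, Matrix.isUnit_diagonal, Pi.isUnit_iff]
  exact fun k => (zpow_ne_zero _ q_ne_zero).isUnit

lemma isUnit_G1 (N : ℕ) : IsUnit (G1 N) := by
  rw [G1_eq_diagonal, Matrix.isUnit_diagonal, Pi.isUnit_iff]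
  exact fun p => (zpow_ne_zero _ q_ne_zero).isUnit

lemma isUnit_G2 (N : ℕ) : IsUnit (G2 N) := by
  rw [G2_eq_diagonal, Matrix.isUnit_diagonal, Pi.isUnit_iff]
  exact fun p => (zpow_ne_zero _ q_ne_zero).isUnit

lemma diagBlock_conj_G1 {N : ℕ} (B : Matrix (Fin N) (Fin N) K) :
    G1 N * diagBlock B * (G1 N)⁻¹ = diagBlock (Gdiag N * B * (Gdiag N)⁻¹) := by
  have hu := (Matrix.isUnit_iff_isUnit_det _).1 (isUnit_G1 N)
  have hd := (Matrix.isUnit_iff_isUnit_det _).1 (isUnit_Gdiag N)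
  suffices h : G1 N * diagBlock B = diagBlock (Gdiag N * B * (Gdiag N)⁻¹) * G1 N by
    rw [h, Matrix.mul_nonsing_inv_cancel_right _ _ hu]
  ext ⟨a, b⟩ ⟨c, d⟩
  have hz := zpow_ne_zero (2 * ((c : ℕ) + 1) : ℤ) q_ne_zero
  rw [G1_eq_diagonal, Gdiag_inv, Gdiag]
  simp only [diagBlock, Matrix.diagonal_mul, Matrix.mul_diagonal, Matrix.of_apply,
    Prod.mk.injEq, neg_mul, zpow_neg]
  grind

lemma diagBlock_conj_G2 {N : ℕ} (B : Matrix (Fin N) (Fin N) K) :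
    G2 N * diagBlock B * (G2 N)⁻¹ = diagBlock (Gdiag N * B * (Gdiag N)⁻¹) := by
  have hu := (Matrix.isUnit_iff_isUnit_det _).1 (isUnit_G2 N)
  suffices h : G2 N * diagBlock B = diagBlock (Gdiag N * B * (Gdiag N)⁻¹) * G2 N by
    rw [h, Matrix.mul_nonsing_inv_cancel_right _ _ hu]
  ext ⟨a, b⟩ ⟨c, d⟩
  have hz := zpow_ne_zero (2 * ((c : ℕ) + 1) : ℤ) q_ne_zero
  rw [G2_eq_diagonal, Gdiag_inv, Gdiag]
  simp only [diagBlock, Matrix.diagonal_mul, Matrix.mul_diagonal, Matrix.of_apply,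
    Prod.mk.injEq, neg_mul, zpow_neg]
  grind

lemma sum_range_lowerTri (i j n : ℕ) :
    ∑ k ∈ Finset.range n, (if i = k then q else if k < i then q - q⁻¹ else 0) *
      ((if k = j then q⁻¹ else if j < k then -(q - q⁻¹) else 0) *
        (q ^ (2 * j) * (q ^ (2 * k))⁻¹)) =
    if n ≤ j ∨ i < j then 0
    else if n ≤ i then (q - q⁻¹) * (q * q ^ (2 * j) * (q ^ (2 * n))⁻¹)
    else if i = j then 1 else 0 := by
  have hq := q_ne_zero
  induction n with
  | zero => simp
  | succ n ih =>
    rw [Finset.sum_range_succ, ih]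
    have hn := pow_ne_zero (2 * n) hq
    have hs : q ^ (2 * (n + 1)) = q ^ (2 * n) * q ^ 2 := by ring
    rcases lt_trichotomy n j with h | rfl | h
    · grind
    · rw [hs]
      rcases lt_trichotomy i n with h' | rfl | h'
      · grind
      · simp
        field_simp
      · have h1 : i ≠ n := by omega
        have h2 : ¬ i < n := by omega
        have h3 : n + 1 ≤ i := by omega
        simp only [le_refl, h', h1, h2, h3, true_or, if_true, if_false, Nat.not_succ_le_self,
          or_self]
        field_simp
        ring
    · rw [hs]
      have h0 : ¬ n ≤ j := by omega
      have h0' : ¬ n + 1 ≤ j := by omega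
      have h0'' : n ≠ j := by omega
      rcases lt_trichotomy i n with h' | rfl | h'
      · have h1 : i ≠ n := by omega
        have h2 : ¬ n < i := by omega
        have h3 : ¬ n ≤ i := by omega
        have h4 : ¬ n + 1 ≤ i := by omega
        simp [h0, h0', h1, h2, h3, h4]
      · have h1 : ¬ i < j := by omega
        simp [h0, h0', h0'', h, h1]
        field_simp
        ring
      · have h1 : i ≠ n := by omega
        have h2 : ¬ i < j := by omega
        have h3 : n ≤ i := by omega
        have h4 : n + 1 ≤ i := by omega
        simp only [h0, h0', h0'', h1, h2, h3, h4, h', h, or_self, if_true, if_false]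
        field_simp
        ring

lemma lowerTri_mul_conj (N : ℕ) :
    lowerTri N q (q - q⁻¹) * (Gdiag N * lowerTri N q⁻¹ (-(q - q⁻¹)) * (Gdiag N)⁻¹) = 1 := by
  have hq := q_ne_zero
  ext i j
  have hsum := sum_range_lowerTri i j N
  rw [← Fin.sum_univ_eq_sum_range] at hsum
  have hi := i.isLt
  have hj := j.isLt
  rw [Matrix.mul_apply, Gdiag_inv, Gdiag, Matrix.one_apply]
  trans (if N ≤ (j : ℕ) ∨ (i : ℕ) < j then 0
    else if N ≤ (i : ℕ) then (q - q⁻¹) * (q * q ^ (2 * (j : ℕ)) * (q ^ (2 * N))⁻¹)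
    else if (i : ℕ) = j then 1 else 0)
  · rw [← hsum]
    refine Finset.sum_congr rfl fun k _ => ?_
    have hz : q ^ (-(2 : ℤ) * ((k : ℕ) + 1)) * q ^ ((2 : ℤ) * ((j : ℕ) + 1)) =
        q ^ (2 * (j : ℕ)) * (q ^ (2 * (k : ℕ)))⁻¹ := by
      rw [← zpow_natCast, ← zpow_natCast, ← zpow_neg, ← zpow_add₀ hq, ← zpow_add₀ hq]
      congr 1
      push_cast
      ring
    simp only [Matrix.mul_diagonal, Matrix.diagonal_mul, lowerTri, Matrix.of_apply, Fin.ext_iff,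
      Fin.lt_def]
    rw [← hz]
    ring
  · grind

lemma pt2_Rmat_mul_conj (N : ℕ) :
    pt2 (Rmat N) * (G1 N * pt1 ((flip21 (Rmat N))⁻¹) * (G1 N)⁻¹) = 1 := by
  rw [flip21_Rmat_inv, pt1_flipRmatInv, diagBlock_conj_G1, pt2_Rmat, diagBlock_mul,
    lowerTri_mul_conj, diagBlock_one]

lemma conj_G1_eq_conj_G2 (N : ℕ) :
    G1 N * pt1 ((flip21 (Rmat N))⁻¹) * (G1 N)⁻¹ =
      G2 N * pt1 ((flip21 (Rmat N))⁻¹) * (G2 N)⁻¹ := by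
  rw [flip21_Rmat_inv, pt1_flipRmatInv, diagBlock_conj_G1, diagBlock_conj_G2]

lemma diagBlock_transpose {N : ℕ} (B : Matrix (Fin N) (Fin N) K) :
    (diagBlock B).transpose = diagBlock B.transpose := by
  ext ⟨a, b⟩ ⟨c, d⟩
  simp only [diagBlock, Matrix.of_apply, Matrix.transpose_apply, Prod.mk.injEq]
  grind

lemma conj_G1_pt1_Rmat_eq_conj_G2 (N : ℕ) :
    G1 N * pt1 (Rmat N) * (G1 N)⁻¹ = G2 N * pt1 (Rmat N) * (G2 N)⁻¹ := by
  rw [pt1_eq_transpose, pt2_Rmat, diagBlock_transpose, diagBlock_conj_G1, diagBlock_conj_G2]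

lemma pt2_flip21_inv_mul_conj (N : ℕ) :
    pt2 ((flip21 (Rmat N))⁻¹) * (G1 N * pt1 (Rmat N) * (G1 N)⁻¹) = 1 := by
  have hu := (Matrix.isUnit_iff_isUnit_det _).1 (isUnit_G1 N)
  have hG : (G1 N).transpose = G1 N := by
    rw [G1_eq_diagonal, Matrix.diagonal_transpose]
  have h : pt2 (Rmat N) * G1 N * pt1 ((flip21 (Rmat N))⁻¹) = G1 N := by
    have h := congrArg (· * G1 N) (pt2_Rmat_mul_conj N)
    simpa only [← Matrix.mul_assoc, Matrix.nonsing_inv_mul_cancel_right _ _ hu, one_mul] using h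
  have h' := congrArg Matrix.transpose h
  rw [Matrix.transpose_mul, Matrix.transpose_mul, hG, ← pt2_eq_transpose,
    ← pt1_eq_transpose] at h'
  rw [← Matrix.mul_assoc, h', Matrix.mul_nonsing_inv _ hu]

theorem stmt3 (N : ℕ) (hN : 1 ≤ N) :
    IsUnit (pt2 (Rmat N)) ∧
    (pt2 (Rmat N))⁻¹ = G1 N * pt1 ((flip21 (Rmat N))⁻¹) * (G1 N)⁻¹ ∧
    (pt2 (Rmat N))⁻¹ = G2 N * pt1 ((flip21 (Rmat N))⁻¹) * (G2 N)⁻¹ ∧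
    IsUnit (pt2 ((flip21 (Rmat N))⁻¹)) ∧
    (pt2 ((flip21 (Rmat N))⁻¹))⁻¹ = G1 N * pt1 (Rmat N) * (G1 N)⁻¹ ∧
    (pt2 ((flip21 (Rmat N))⁻¹))⁻¹ = G2 N * pt1 (Rmat N) * (G2 N)⁻¹ := by
  have h₁ := pt2_Rmat_mul_conj N
  have h₂ := pt2_flip21_inv_mul_conj N
  have e₁ := Matrix.inv_eq_right_inv h₁
  have e₂ := Matrix.inv_eq_right_inv h₂
  exact ⟨IsUnit.of_mul_eq_one _ h₁, e₁, e₁.trans (conj_G1_eq_conj_G2 N),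
    IsUnit.of_mul_eq_one _ h₂, e₂, e₂.trans (conj_G1_pt1_Rmat_eq_conj_G2 N)⟩
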